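/- Let A be an associative unital R-algebra, M_r a chain complex of right A-modules, and M_l a chain complex of left A-modules which is dg-flat (tensoring over A with M_l preserves quasi-isomorphisms of right A-module complexes). Then the canonical augmentation map p : B(M_r, A, M_l) → M_r ⊗_A M_l from the two-sided bar complex to the tensor product over A is a quasi-isomorphism of R-chain complexes. -/

import Mathlib

open DirectSum MulOpposite
open scoped TensorProduct

/-- Elementwise formulation of "quasi-isomorphism" for a map of ℤ-graded chain complexes
(differentials lower degree by one). -/
def IsQIso (X Y : ℤ → Type) [∀ k, AddCommGroup (X k)] [∀ k, AddCommGroup (Y k)]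
    (dX : ∀ k : ℤ, X (k + 1) → X k) (dY : ∀ k : ℤ, Y (k + 1) → Y k)
    (φ : ∀ k : ℤ, X k → Y k) : Prop :=
  ∀ k : ℤ,
    (∀ y : Y (k + 1), dY k y = 0 →
      ∃ x : X (k + 1), dX k x = 0 ∧ ∃ z : Y (k + 1 + 1), φ (k + 1) x - y = dY (k + 1) z) ∧
    (∀ x : X (k + 1), dX k x = 0 → (∃ z : Y (k + 1 + 1), φ (k + 1) x = dY (k + 1) z) →
      ∃ w : X (k + 1 + 1), x = dX (k + 1) w)

/-- Relations presenting `N ⊗_A M` as a quotient of `N ⊗_R M`. -/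
abbrev mixedRel (R A : Type) [CommRing R] [Ring A] [Algebra R A]
    (N M : Type) [AddCommGroup N] [Module R N] [Module Aᵐᵒᵖ N]
    [AddCommGroup M] [Module R M] [Module A M] : Submodule R (N ⊗[R] M) :=
  Submodule.span R {x | ∃ (n : N) (a : A) (m : M),
    x = (op a • n) ⊗ₜ[R] m - n ⊗ₜ[R] (a • m)}

/-- The tensor product `N ⊗_A M` over the `R`-algebra `A`. -/
abbrev TensA (R A : Type) [CommRing R] [Ring A] [Algebra R A]
    (N M : Type) [AddCommGroup N] [Module R N] [Module Aᵐᵒᵖ N]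
    [AddCommGroup M] [Module R M] [Module A M] : Type :=
  (N ⊗[R] M) ⧸ mixedRel R A N M

/-- Degree `k` part of the total tensor product complex `N ⊗_A M`. -/
abbrev TotT (R A : Type) [CommRing R] [Ring A] [Algebra R A]
    (N : ℤ → Type) [∀ k, AddCommGroup (N k)] [∀ k, Module R (N k)] [∀ k, Module Aᵐᵒᵖ (N k)]
    (M : ℤ → Type) [∀ k, AddCommGroup (M k)] [∀ k, Module R (M k)] [∀ k, Module A (M k)]
    (k : ℤ) : Type :=
  ⨁ (p : {p : ℤ × ℤ // p.1 + p.2 = k}), TensA R A (N p.1.1) (M p.1.2)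

/-- Inclusion of the `(i,j)` component of the total tensor product complex. -/
noncomputable abbrev lofTot (R A : Type) [CommRing R] [Ring A] [Algebra R A]
    (N : ℤ → Type) [∀ k, AddCommGroup (N k)] [∀ k, Module R (N k)] [∀ k, Module Aᵐᵒᵖ (N k)]
    (M : ℤ → Type) [∀ k, AddCommGroup (M k)] [∀ k, Module R (M k)] [∀ k, Module A (M k)]
    (k : ℤ) (p : {p : ℤ × ℤ // p.1 + p.2 = k}) :
    TensA R A (N p.1.1) (M p.1.2) →ₗ[R] TotT R A N M k :=
  DirectSum.lof R {p : ℤ × ℤ // p.1 + p.2 = k}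
    (fun p => TensA R A (N p.1.1) (M p.1.2)) p

/-- The `(n, i, j)` component `Mr_i ⊗ A^{⊗n} ⊗ Ml_j` of the two-sided bar complex
`B(Mr, A, Ml)`. -/
def BarComp (R A : Type) [CommRing R] [Ring A] [Algebra R A]
    (Mr Ml : ℤ → Type) [∀ k, AddCommGroup (Mr k)] [∀ k, Module R (Mr k)]
    [∀ k, AddCommGroup (Ml k)] [∀ k, Module R (Ml k)] (q : ℕ × ℤ × ℤ) : Type :=
  Mr q.2.1 ⊗[R] ((PiTensorProduct R (fun _ : Fin q.1 => A)) ⊗[R] Ml q.2.2)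

noncomputable instance (R A : Type) [CommRing R] [Ring A] [Algebra R A]
    (Mr Ml : ℤ → Type) [∀ k, AddCommGroup (Mr k)] [∀ k, Module R (Mr k)]
    [∀ k, AddCommGroup (Ml k)] [∀ k, Module R (Ml k)] (q : ℕ × ℤ × ℤ) :
    AddCommGroup (BarComp R A Mr Ml q) :=
  inferInstanceAs (AddCommGroup
    (Mr q.2.1 ⊗[R] ((PiTensorProduct R (fun _ : Fin q.1 => A)) ⊗[R] Ml q.2.2)))

noncomputable instance (R A : Type) [CommRing R] [Ring A] [Algebra R A]
    (Mr Ml : ℤ → Type) [∀ k, AddCommGroup (Mr k)] [∀ k, Module R (Mr k)]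
    [∀ k, AddCommGroup (Ml k)] [∀ k, Module R (Ml k)] (q : ℕ × ℤ × ℤ) :
    Module R (BarComp R A Mr Ml q) :=
  inferInstanceAs (Module R
    (Mr q.2.1 ⊗[R] ((PiTensorProduct R (fun _ : Fin q.1 => A)) ⊗[R] Ml q.2.2)))

/-- Degree `m` part of the two-sided bar complex `B(Mr, A, Ml)` of a complex of right
`A`-modules `Mr` and a complex of left `A`-modules `Ml`: the sum over simplicial level
`n` and internal bidegrees `(i, j)` with `n + i + j = m` of `Mr_i ⊗ A^{⊗n} ⊗ Ml_j`. -/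
abbrev BarC (R A : Type) [CommRing R] [Ring A] [Algebra R A]
    (Mr Ml : ℤ → Type) [∀ k, AddCommGroup (Mr k)] [∀ k, Module R (Mr k)]
    [∀ k, AddCommGroup (Ml k)] [∀ k, Module R (Ml k)] (m : ℤ) : Type :=
  ⨁ (q : {q : ℕ × ℤ × ℤ // (q.1 : ℤ) + q.2.1 + q.2.2 = m}), BarComp R A Mr Ml q.1

/-- Inclusion of the `(n, i, j)` component of the bar complex. -/
noncomputable abbrev lofBar (R A : Type) [CommRing R] [Ring A] [Algebra R A]
    (Mr Ml : ℤ → Type) [∀ k, AddCommGroup (Mr k)] [∀ k, Module R (Mr k)]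
    [∀ k, AddCommGroup (Ml k)] [∀ k, Module R (Ml k)] (m : ℤ)
    (q : {q : ℕ × ℤ × ℤ // (q.1 : ℤ) + q.2.1 + q.2.2 = m}) :
    BarComp R A Mr Ml q.1 →ₗ[R] BarC R A Mr Ml m :=
  DirectSum.lof R {q : ℕ × ℤ × ℤ // (q.1 : ℤ) + q.2.1 + q.2.2 = m}
    (fun q => BarComp R A Mr Ml q.1) q

/-- Merging the adjacent slots `j` and `j+1` of a tuple by multiplication. -/
def mergeAt {A : Type} [Mul A] {n : ℕ} (f : Fin (n + 1) → A) (j : Fin n) : Fin n → A :=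
  fun i => if (i : ℕ) < (j : ℕ) then f i.castSucc
    else if (i : ℕ) = (j : ℕ) then f i.castSucc * f i.succ else f i.succ


namespace BarAux
section W
set_option linter.unusedSectionVars false
variable (R A : Type) [CommRing R] [Ring A] [Algebra R A]
variable (M : Type) [AddCommGroup M] [Module R M] [Module Aᵐᵒᵖ M] [IsScalarTower R Aᵐᵒᵖ M]

abbrev P (n : ℕ) : Type := PiTensorProduct R (fun _ : Fin n => A)

abbrev W (n : ℕ) : Type := A ⊗[R] (M ⊗[R] P R A n)


/-- appending -/
noncomputable def eP (n : ℕ) : P R A n ⊗[R] A ≃ₗ[R] P R A (n + 1) :=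
  (TensorProduct.congr (LinearEquiv.refl R _)
    (PiTensorProduct.subsingletonEquiv (R := R) (s := fun _ : Fin 1 => A) (0 : Fin 1)).symm).trans
  (TensorPower.mulEquiv (R := R) (M := A) (n := n) (m := 1))

lemma eP_tprod (n : ℕ) (f : Fin n → A) (a : A) :
    eP R A n (PiTensorProduct.tprod R f ⊗ₜ a) = PiTensorProduct.tprod R (Fin.snoc (α := fun _ => A) f a) := by
  simp only [eP, LinearEquiv.trans_apply, TensorProduct.congr_tmul, LinearEquiv.refl_apply]
  have : (PiTensorProduct.subsingletonEquiv (R := R) (s := fun _ : Fin 1 => A) (0 : Fin 1)).symm a = PiTensorProduct.tprod R (fun _ => a) := by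
    rw [LinearEquiv.symm_apply_eq]; simp
  rw [this]
  have := TensorPower.tprod_mul_tprod (R := R) (M := A) f (fun _ : Fin 1 => a)
  rw [TensorPower.gMul_def] at this
  rw [this]
  rw [Fin.append_right_eq_snoc]

noncomputable def eW (n : ℕ) : W R A M n ≃ₗ[R] M ⊗[R] P R A (n + 1) :=
  ((TensorProduct.comm R _ _).trans (TensorProduct.assoc R _ _ _)).trans
    (TensorProduct.congr (LinearEquiv.refl R _) (eP R A n))

lemma eW_tmul (n : ℕ) (a : A) (m : M) (f : Fin n → A) :
    eW R A M n (a ⊗ₜ (m ⊗ₜ PiTensorProduct.tprod R f)) =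
      m ⊗ₜ PiTensorProduct.tprod R (Fin.snoc (α := fun _ => A) f a) := by
  simp [eW, eP_tprod]

variable {R A M}
noncomputable def lft {Q X : Type} [AddCommGroup Q] [Module R Q] [AddCommGroup X] [Module R X]
    [Module Aᵐᵒᵖ X] [IsScalarTower R Aᵐᵒᵖ X] (g : Q →ₗ[R] X) : A ⊗[R] Q →ₗ[Aᵐᵒᵖ] X :=
  TensorProduct.AlgebraTensorModule.lift
   { toFun := fun a => op a • g
     map_add' := fun a b => by ext; simp [add_smul]
     map_smul' := fun a b => by ext; simp [mul_smul] }

@[simp] lemma lft_tmul {Q X : Type} [AddCommGroup Q] [Module R Q] [AddCommGroup X] [Module R X]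
    [Module Aᵐᵒᵖ X] [IsScalarTower R Aᵐᵒᵖ X] (g : Q →ₗ[R] X) (a : A) (q : Q) :
    lft g (a ⊗ₜ[R] q) = op a • g q := rfl

variable (R A M)
noncomputable def sW (n : ℕ) : W R A M n →ₗ[R] W R A M (n + 1) :=
  (TensorProduct.mk R A _ 1) ∘ₗ (eW R A M n).toLinearMap

noncomputable def epsW : W R A M 0 →ₗ[Aᵐᵒᵖ] M :=
  lft ((TensorProduct.congr (LinearEquiv.refl R M)
    (PiTensorProduct.isEmptyEquiv (R := R) (s := fun _ : Fin 0 => A) (Fin 0))).trans (TensorProduct.rid R M)).toLinearMap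

noncomputable def etaW : M →ₗ[R] W R A M 0 :=
  (TensorProduct.mk R A _ 1) ∘ₗ ((TensorProduct.mk R M (P R A 0)).flip (PiTensorProduct.tprod R Fin.elim0))

lemma epsW_tmul (a : A) (m : M) (f : Fin 0 → A) :
    epsW R A M (a ⊗ₜ (m ⊗ₜ PiTensorProduct.tprod R f)) = op a • m := by
  simp [epsW]

lemma etaW_apply (m : M) : etaW R A M m = 1 ⊗ₜ (m ⊗ₜ PiTensorProduct.tprod R Fin.elim0) := rfl

lemma epsW_etaW (m : M) : epsW R A M (etaW R A M m) = m := by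
  rw [etaW_apply, epsW_tmul]; simp

noncomputable def bW : ∀ n : ℕ, W R A M (n + 1) →ₗ[Aᵐᵒᵖ] W R A M n
  | 0 => lft ((etaW R A M ∘ₗ (epsW R A M).restrictScalars R - LinearMap.id) ∘ₗ (eW R A M 0).symm.toLinearMap)
  | n + 1 => lft ((sW R A M n ∘ₗ (bW n).restrictScalars R + ((-1 : ℤ) ^ n) • LinearMap.id) ∘ₗ
      (eW R A M (n + 1)).symm.toLinearMap)

lemma bW_zero (a : A) (w : W R A M 0) :
    bW R A M 0 (a ⊗ₜ eW R A M 0 w) = op a • (etaW R A M (epsW R A M w) - w) := by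
  simp [bW]

lemma bW_succ (n : ℕ) (a : A) (w : W R A M (n + 1)) :
    bW R A M (n + 1) (a ⊗ₜ eW R A M (n + 1) w) =
      op a • (sW R A M n (bW R A M n w) + ((-1 : ℤ) ^ n) • w) := by
  simp [bW]

lemma bW_sW_zero (w : W R A M 0) :
    bW R A M 0 (sW R A M 0 w) = etaW R A M (epsW R A M w) - w := by
  simpa [sW] using bW_zero R A M 1 w

lemma bW_sW_succ (n : ℕ) (w : W R A M (n + 1)) :
    bW R A M (n + 1) (sW R A M (n + 1) w) = sW R A M n (bW R A M n w) + ((-1 : ℤ) ^ n) • w := by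
  simpa [sW] using bW_succ R A M n 1 w

variable {R A M} in
lemma W_ind {n : ℕ} {X : Type} [AddCommGroup X] [Module R X] {f g : W R A M n →ₗ[R] X}
    (h : ∀ a m u, f (a ⊗ₜ (m ⊗ₜ PiTensorProduct.tprod R u)) = g (a ⊗ₜ (m ⊗ₜ PiTensorProduct.tprod R u))) :
    f = g := by
  ext a m u
  exact h a m u

/-- generators through `eW` -/
lemma W_ind' {n : ℕ} {X : Type} [AddCommGroup X] {f g : W R A M (n + 1) →+ X}
    (h : ∀ a w, f (a ⊗ₜ eW R A M n w) = g (a ⊗ₜ eW R A M n w)) (w) :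
    f w = g w := by
  induction w using TensorProduct.induction_on with
  | zero => simp
  | add x y hx hy => simp [hx, hy]
  | tmul a q =>
    obtain ⟨w, rfl⟩ := (eW R A M n).surjective q
    exact h a w

lemma eps_b (w : W R A M 1) : epsW R A M (bW R A M 0 w) = 0 := by
  refine W_ind' R A M (f := (epsW R A M ∘ₗ bW R A M 0).toAddMonoidHom) (g := 0) ?_ w
  intro a w
  simp [bW_zero, epsW_etaW]

lemma b_b (n : ℕ) (w : W R A M (n + 1 + 1)) : bW R A M n (bW R A M (n + 1) w) = 0 := by
  induction n with
  | zero =>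
    refine W_ind' R A M (f := (bW R A M 0 ∘ₗ bW R A M 1).toAddMonoidHom) (g := 0) ?_ w
    intro a w
    simp [bW_succ, bW_sW_zero, eps_b]
  | succ n ih =>
    refine W_ind' R A M (f := (bW R A M (n + 1) ∘ₗ bW R A M (n + 2)).toAddMonoidHom) (g := 0) ?_ w
    intro a w
    simp [bW_succ, bW_sW_succ, ih, pow_succ]

variable {R A M}
variable {M' : Type} [AddCommGroup M'] [Module R M'] [Module Aᵐᵒᵖ M'] [IsScalarTower R Aᵐᵒᵖ M']
variable (R) in
noncomputable def mW (φ : M →ₗ[Aᵐᵒᵖ] M') (n : ℕ) : W R A M n →ₗ[Aᵐᵒᵖ] W R A M' n :=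
  TensorProduct.AlgebraTensorModule.map LinearMap.id
    (TensorProduct.map (φ.restrictScalars R) LinearMap.id)

@[simp] lemma mW_tmul (φ : M →ₗ[Aᵐᵒᵖ] M') (n : ℕ) (a : A) (m : M) (t : P R A n) :
    mW R φ n (a ⊗ₜ (m ⊗ₜ t)) = a ⊗ₜ (φ m ⊗ₜ t) := rfl

lemma mW_one (φ : M →ₗ[Aᵐᵒᵖ] M') (n : ℕ) (a : A) (q : M ⊗[R] P R A n) :
    mW R φ n (a ⊗ₜ q) = a ⊗ₜ TensorProduct.map (φ.restrictScalars R) LinearMap.id q := rfl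

lemma eW_mW (φ : M →ₗ[Aᵐᵒᵖ] M') (n : ℕ) (w : W R A M n) :
    TensorProduct.map (φ.restrictScalars R) LinearMap.id (eW R A M n w) = eW R A M' n (mW R φ n w) := by
  refine LinearMap.congr_fun (f := TensorProduct.map (φ.restrictScalars R) LinearMap.id ∘ₗ (eW R A M n).toLinearMap)
    (g := (eW R A M' n).toLinearMap ∘ₗ (mW R φ n).restrictScalars R) (W_ind ?_) w
  intro a m u
  simp [eW_tmul]

lemma sW_mW (φ : M →ₗ[Aᵐᵒᵖ] M') (n : ℕ) (w : W R A M n) :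
    sW R A M' n (mW R φ n w) = mW R φ (n + 1) (sW R A M n w) := by
  simp [sW, ← eW_mW, mW_one]

lemma epsW_mW (φ : M →ₗ[Aᵐᵒᵖ] M') (w : W R A M 0) :
    epsW R A M' (mW R φ 0 w) = φ (epsW R A M w) := by
  refine LinearMap.congr_fun (f := (epsW R A M' ∘ₗ mW R φ 0).restrictScalars R)
    (g := (φ ∘ₗ epsW R A M).restrictScalars R) (W_ind ?_) w
  intro a m u
  simp [epsW_tmul]

lemma etaW_mW (φ : M →ₗ[Aᵐᵒᵖ] M') (m : M) :
    mW R φ 0 (etaW R A M m) = etaW R A M' (φ m) := rfl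

lemma bW_mW (φ : M →ₗ[Aᵐᵒᵖ] M') (n : ℕ) (w : W R A M (n + 1)) :
    bW R A M' n (mW R φ (n + 1) w) = mW R φ n (bW R A M n w) := by
  induction n with
  | zero =>
    refine W_ind' R A M (f := (bW R A M' 0 ∘ₗ mW R φ 1).toAddMonoidHom)
      (g := (mW R φ 0 ∘ₗ bW R A M 0).toAddMonoidHom) ?_ w
    intro a w
    simp [mW_one, eW_mW, bW_zero, epsW_mW, etaW_mW]
  | succ n ih =>
    refine W_ind' R A M (f := (bW R A M' (n + 1) ∘ₗ mW R φ (n + 2)).toAddMonoidHom)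
      (g := (mW R φ (n + 1) ∘ₗ bW R A M (n + 1)).toAddMonoidHom) ?_ w
    intro a w
    simp [mW_one, eW_mW, bW_succ, sW_mW, ih]

lemma mW_mW_zero {M'' : Type} [AddCommGroup M''] [Module R M''] [Module Aᵐᵒᵖ M'']
    [IsScalarTower R Aᵐᵒᵖ M''] (φ : M →ₗ[Aᵐᵒᵖ] M') (ψ : M' →ₗ[Aᵐᵒᵖ] M'') (h : ψ.comp φ = 0)
    (n : ℕ) (w : W R A M n) : mW R ψ n (mW R φ n w) = 0 := by
  refine LinearMap.congr_fun (f := (mW R ψ n ∘ₗ mW R φ n).restrictScalars R)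
    (g := 0) (W_ind ?_) w
  intro a m u
  have : ψ (φ m) = 0 := LinearMap.congr_fun h m
  simp [this]

/-- explicit formula for the bar differential -/
lemma bW_formula (n : ℕ) (a : A) (m : M) (f : Fin (n + 1) → A) :
    bW R A M n (a ⊗ₜ (m ⊗ₜ PiTensorProduct.tprod R f)) =
      a ⊗ₜ ((op (f 0) • m) ⊗ₜ PiTensorProduct.tprod R (fun l : Fin n => f l.succ))
      + (∑ l : Fin n, ((-1 : ℤ) ^ ((l : ℕ) + 1)) •
          (a ⊗ₜ[R] (m ⊗ₜ[R] PiTensorProduct.tprod R (mergeAt f l))))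
      + ((-1 : ℤ) ^ (n + 1)) • ((f (Fin.last n) * a) ⊗ₜ
          (m ⊗ₜ PiTensorProduct.tprod R (fun l : Fin n => f l.castSucc))) := by
  induction n generalizing a with
  | zero =>
    have hf : f = Fin.snoc (α := fun _ => A) (fun l : Fin 0 => f l.castSucc) (f (Fin.last 0)) :=
      (Fin.snoc_init_self f).symm
    have key := bW_zero R A M a (f (Fin.last 0) ⊗ₜ (m ⊗ₜ PiTensorProduct.tprod R (fun l : Fin 0 => f l.castSucc)))
    rw [eW_tmul, ← hf, epsW_tmul, etaW_apply] at key
    rw [key]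
    have h1 : (Fin.elim0 : Fin 0 → A) = fun l : Fin 0 => f l.succ := by ext i; exact i.elim0
    rw [h1]
    simp [TensorProduct.smul_tmul', sub_eq_add_neg]
  | succ n ih =>
    have hf : f = Fin.snoc (α := fun _ => A) (fun l : Fin (n + 1) => f l.castSucc) (f (Fin.last (n + 1))) :=
      (Fin.snoc_init_self f).symm
    have key := bW_succ R A M n a (f (Fin.last (n + 1)) ⊗ₜ (m ⊗ₜ PiTensorProduct.tprod R (fun l : Fin (n + 1) => f l.castSucc)))
    rw [eW_tmul, ← hf, ih] at key
    rw [key, Fin.sum_univ_castSucc]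
    have h1 : Fin.snoc (α := fun _ => A) (fun l : Fin n => f l.succ.castSucc) (f (Fin.last (n + 1)))
        = fun l : Fin (n + 1) => f l.succ := by
      ext i; refine Fin.lastCases ?_ (fun i => ?_) i <;> simp
    have h2 : ∀ j : Fin n, Fin.snoc (α := fun _ => A) (mergeAt (fun l : Fin (n + 1) => f l.castSucc) j) (f (Fin.last (n + 1)))
        = mergeAt f j.castSucc := by
      intro j
      ext i; refine Fin.lastCases ?_ (fun i => ?_) i
      · have := j.isLt
        simp only [Fin.snoc_last, mergeAt, Fin.val_last, Fin.val_castSucc, Fin.succ_last]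
        rw [if_neg (by omega), if_neg (by omega)]
      · simp [mergeAt]
    have h3 : Fin.snoc (α := fun _ => A) (fun l : Fin n => f l.castSucc.castSucc) (f (Fin.last n).castSucc * f (Fin.last (n + 1)))
        = mergeAt f (Fin.last n) := by
      ext i; refine Fin.lastCases ?_ (fun i => ?_) i
      · simp [mergeAt]
      · simp [mergeAt]
    have hz : ∀ (z : ℤ) (w : W R A M (n + 1)), op a • z • w = z • op a • w :=
      fun z w => smul_comm _ _ _
    have hs : ∀ (c : A) (m : M) (g : Fin n → A),
        op a • sW R A M n (c ⊗ₜ (m ⊗ₜ PiTensorProduct.tprod R g)) =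
          a ⊗ₜ (m ⊗ₜ PiTensorProduct.tprod R (Fin.snoc (α := fun _ => A) g c)) := by
      intro c m g
      simp [sW, eW_tmul, TensorProduct.smul_tmul']
    simp only [map_add, map_sum, map_zsmul, smul_add, Finset.smul_sum, hz, hs, h1, h2, h3]
    simp only [TensorProduct.smul_tmul', op_smul_eq_mul, pow_succ, Fin.castSucc_zero, Fin.val_castSucc, Fin.val_last]
    simp [add_assoc]
end W
end BarAux

namespace BarAux
section N
set_option linter.unusedSectionVars false
variable (R A : Type) [CommRing R] [Ring A] [Algebra R A]
variable (Mr : ℤ → Type) [∀ k, AddCommGroup (Mr k)] [∀ k, Module R (Mr k)]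
    [∀ k, Module Aᵐᵒᵖ (Mr k)] [∀ k, IsScalarTower R Aᵐᵒᵖ (Mr k)]

/-- Total complex of `B(Mr, A, A)`. -/
def NN (k : ℤ) : Type :=
  ⨁ (q : {q : ℕ × ℤ // (q.1 : ℤ) + q.2 = k}), W R A (Mr q.1.2) q.1.1

noncomputable instance (k : ℤ) : AddCommGroup (NN R A Mr k) :=
  inferInstanceAs (AddCommGroup
    (⨁ (q : {q : ℕ × ℤ // (q.1 : ℤ) + q.2 = k}), W R A (Mr q.1.2) q.1.1))

noncomputable instance (k : ℤ) : Module R (NN R A Mr k) :=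
  inferInstanceAs (Module R
    (⨁ (q : {q : ℕ × ℤ // (q.1 : ℤ) + q.2 = k}), W R A (Mr q.1.2) q.1.1))

noncomputable instance (k : ℤ) : Module Aᵐᵒᵖ (NN R A Mr k) :=
  inferInstanceAs (Module Aᵐᵒᵖ
    (⨁ (q : {q : ℕ × ℤ // (q.1 : ℤ) + q.2 = k}), W R A (Mr q.1.2) q.1.1))

instance (k : ℤ) : IsScalarTower R Aᵐᵒᵖ (NN R A Mr k) :=
  inferInstanceAs (IsScalarTower R Aᵐᵒᵖ
    (⨁ (q : {q : ℕ × ℤ // (q.1 : ℤ) + q.2 = k}), W R A (Mr q.1.2) q.1.1))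

noncomputable def lofN (k : ℤ) (q : {q : ℕ × ℤ // (q.1 : ℤ) + q.2 = k}) :
    W R A (Mr q.1.2) q.1.1 →ₗ[Aᵐᵒᵖ] NN R A Mr k :=
  DirectSum.lof Aᵐᵒᵖ {q : ℕ × ℤ // (q.1 : ℤ) + q.2 = k} (fun q => W R A (Mr q.1.2) q.1.1) q

variable {R A Mr}

noncomputable def descA {k : ℤ} {X : Type} [AddCommGroup X] [Module Aᵐᵒᵖ X]
    (f : ∀ q : {q : ℕ × ℤ // (q.1 : ℤ) + q.2 = k}, W R A (Mr q.1.2) q.1.1 →ₗ[Aᵐᵒᵖ] X) :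
    NN R A Mr k →ₗ[Aᵐᵒᵖ] X :=
  DirectSum.toModule Aᵐᵒᵖ {q : ℕ × ℤ // (q.1 : ℤ) + q.2 = k} X f

lemma descA_lof {k : ℤ} {X : Type} [AddCommGroup X] [Module Aᵐᵒᵖ X]
    (f : ∀ q : {q : ℕ × ℤ // (q.1 : ℤ) + q.2 = k}, W R A (Mr q.1.2) q.1.1 →ₗ[Aᵐᵒᵖ] X) (q w) :
    descA f (lofN R A Mr k q w) = f q w :=
  DirectSum.toModule_lof Aᵐᵒᵖ (φ := f) q w

noncomputable def descR {k : ℤ} {X : Type} [AddCommGroup X] [Module R X]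
    (f : ∀ q : {q : ℕ × ℤ // (q.1 : ℤ) + q.2 = k}, W R A (Mr q.1.2) q.1.1 →ₗ[R] X) :
    NN R A Mr k →ₗ[R] X :=
  DirectSum.toModule R {q : ℕ × ℤ // (q.1 : ℤ) + q.2 = k} X f

lemma descR_lof {k : ℤ} {X : Type} [AddCommGroup X] [Module R X]
    (f : ∀ q : {q : ℕ × ℤ // (q.1 : ℤ) + q.2 = k}, W R A (Mr q.1.2) q.1.1 →ₗ[R] X) (q w) :
    descR f (lofN R A Mr k q w) = f q w :=
  DirectSum.toModule_lof R (φ := f) q w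

lemma NN_ind {k : ℤ} {X : Type} [AddCommMonoid X] {f g : NN R A Mr k →+ X}
    (h : ∀ (n : ℕ) (i : ℤ) (hq : (n : ℤ) + i = k) (w : W R A (Mr i) n),
      f (lofN R A Mr k ⟨(n, i), hq⟩ w) = g (lofN R A Mr k ⟨(n, i), hq⟩ w)) (x : NN R A Mr k) :
    f x = g x := by
  have key : ∀ f g : (⨁ (q : {q : ℕ × ℤ // (q.1 : ℤ) + q.2 = k}), W R A (Mr q.1.2) q.1.1) →+ X,
    (∀ q w, f (DirectSum.of (fun q : {q : ℕ × ℤ // (q.1 : ℤ) + q.2 = k} =>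
      W R A (Mr q.1.2) q.1.1) q w) = g (DirectSum.of (fun q : {q : ℕ × ℤ // (q.1 : ℤ) + q.2 = k} =>
      W R A (Mr q.1.2) q.1.1) q w)) → f = g := by
    intro f g h
    refine DirectSum.addHom_ext' fun q => AddMonoidHom.ext fun w => h q w
  refine DFunLike.congr_fun (key f g ?_) x
  rintro ⟨⟨n, i⟩, hq⟩ w
  exact h n i hq w

lemma NN_indR {k : ℤ} {X : Type} [AddCommGroup X] [Module R X] {f g : NN R A Mr k →ₗ[R] X}
    (h : ∀ (n : ℕ) (i : ℤ) (hq : (n : ℤ) + i = k) (w : W R A (Mr i) n),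
      f (lofN R A Mr k ⟨(n, i), hq⟩ w) = g (lofN R A Mr k ⟨(n, i), hq⟩ w)) (x : NN R A Mr k) :
    f x = g x :=
  NN_ind (f := f.toAddMonoidHom) (g := g.toAddMonoidHom) h x

variable (dMr : ∀ k : ℤ, Mr (k + 1) →ₗ[Aᵐᵒᵖ] Mr k)

def dM' (i i' : ℤ) (h : i' + 1 = i) : Mr i →ₗ[Aᵐᵒᵖ] Mr i' := by
  subst h; exact dMr i'

variable (R) in
noncomputable def dNb (k : ℤ) : ∀ q : {q : ℕ × ℤ // (q.1 : ℤ) + q.2 = k + 1},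
    W R A (Mr q.1.2) q.1.1 →ₗ[Aᵐᵒᵖ] NN R A Mr k
  | ⟨(0, _), _⟩ => 0
  | ⟨(n + 1, i), h⟩ => lofN R A Mr k ⟨(n, i), by push_cast at h; dsimp only; omega⟩ ∘ₗ bW R A (Mr i) n

variable (R) in
noncomputable def dNi (k : ℤ) : ∀ q : {q : ℕ × ℤ // (q.1 : ℤ) + q.2 = k + 1},
    W R A (Mr q.1.2) q.1.1 →ₗ[Aᵐᵒᵖ] NN R A Mr k
  | ⟨(n, i), h⟩ => lofN R A Mr k ⟨(n, i - 1), by dsimp only at h ⊢; omega⟩ ∘ₗ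
      ((-1 : ℤ) ^ n • mW R (dM' dMr i (i - 1) (by omega)) n)

variable (R) in
noncomputable def dN (k : ℤ) : NN R A Mr (k + 1) →ₗ[Aᵐᵒᵖ] NN R A Mr k :=
  descA (fun q => dNb R k q + dNi R dMr k q)

lemma dNi_apply (k : ℤ) (n : ℕ) (i : ℤ) (h : (n : ℤ) + (i + 1) = k + 1)
    (w : W R A (Mr (i + 1)) n) :
    dNi R dMr k ⟨(n, i + 1), h⟩ w =
      (-1 : ℤ) ^ n • lofN R A Mr k ⟨(n, i), by dsimp only; omega⟩ (mW R (dMr i) n w) := by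
  have key : ∀ (j : ℤ) (hj : j + 1 = i + 1), 
      (lofN R A Mr k ⟨(n, j), by dsimp only; omega⟩ ∘ₗ
      ((-1 : ℤ) ^ n • mW R (dM' dMr (i + 1) j hj) n)) w =
      (-1 : ℤ) ^ n • lofN R A Mr k ⟨(n, i), by dsimp only; omega⟩ (mW R (dMr i) n w) := by
    intro j hj
    obtain rfl : j = i := by omega
    rw [LinearMap.comp_apply, LinearMap.smul_apply, map_zsmul]
    rfl
  exact key (i + 1 - 1) (by omega)

lemma dN_zero (k : ℤ) (i : ℤ) (h : ((0 : ℕ) : ℤ) + (i + 1) = k + 1)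
    (w : W R A (Mr (i + 1)) 0) :
    dN R dMr k (lofN R A Mr (k + 1) ⟨(0, i + 1), h⟩ w) =
      lofN R A Mr k ⟨(0, i), by dsimp only; omega⟩ (mW R (dMr i) 0 w) := by
  rw [dN, descA_lof, LinearMap.add_apply, dNi_apply]
  simp [dNb]

lemma dN_succ (k : ℤ) (n : ℕ) (i : ℤ) (h : ((n + 1 : ℕ) : ℤ) + (i + 1) = k + 1)
    (w : W R A (Mr (i + 1)) (n + 1)) :
    dN R dMr k (lofN R A Mr (k + 1) ⟨(n + 1, i + 1), h⟩ w) =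
      lofN R A Mr k ⟨(n, i + 1), by dsimp only; omega⟩ (bW R A (Mr (i + 1)) n w) +
      (-1 : ℤ) ^ (n + 1) • lofN R A Mr k ⟨(n + 1, i), by dsimp only; omega⟩ (mW R (dMr i) (n + 1) w) := by
  rw [dN, descA_lof, LinearMap.add_apply, dNi_apply]
  rfl

lemma dN_dN (hdMr : ∀ k, (dMr k).comp (dMr (k + 1)) = 0) (k : ℤ) :
    (dN R dMr k).comp (dN R dMr (k + 1)) = 0 := by
  refine LinearMap.ext fun x => ?_
  refine NN_ind (f := ((dN R dMr k).comp (dN R dMr (k + 1))).toAddMonoidHom) (g := 0) ?_ x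
  intro n i hq w
  obtain ⟨i, rfl⟩ : ∃ i', i = i' + 1 + 1 := ⟨i - 2, by omega⟩
  simp only [LinearMap.toAddMonoidHom_coe, LinearMap.comp_apply, AddMonoidHom.zero_apply]
  rcases n with _ | _ | n
  · rw [dN_zero, dN_zero, mW_mW_zero _ _ (hdMr i), map_zero]
  · rw [dN_succ, map_add, dN_zero, map_zsmul, dN_succ, mW_mW_zero _ _ (hdMr i), bW_mW]
    simp
  · rw [dN_succ, map_add, dN_succ, map_zsmul, dN_succ, mW_mW_zero _ _ (hdMr i), bW_mW, b_b]
    simp [pow_succ]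

def cM (Mr : ℤ → Type) [∀ k, AddCommGroup (Mr k)]
    [∀ k, Module Aᵐᵒᵖ (Mr k)] {i k : ℤ} (h : i = k) : Mr i →ₗ[Aᵐᵒᵖ] Mr k := by
  subst h; exact LinearMap.id

variable (R A Mr) in
noncomputable def epsNc (k : ℤ) : ∀ q : {q : ℕ × ℤ // (q.1 : ℤ) + q.2 = k},
    W R A (Mr q.1.2) q.1.1 →ₗ[Aᵐᵒᵖ] Mr k
  | ⟨(0, i), h⟩ => cM Mr (by dsimp only at h; omega) ∘ₗ epsW R A (Mr i)
  | ⟨(_ + 1, _), _⟩ => 0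

variable (R A Mr) in
noncomputable def epsN (k : ℤ) : NN R A Mr k →ₗ[Aᵐᵒᵖ] Mr k :=
  descA (epsNc R A Mr k)

lemma epsN_zero (k : ℤ) (h : ((0 : ℕ) : ℤ) + k = k) (w : W R A (Mr k) 0) :
    epsN R A Mr k (lofN R A Mr k ⟨(0, k), h⟩ w) = epsW R A (Mr k) w := by
  rw [epsN, descA_lof]
  rfl

lemma epsN_succ (k : ℤ) (n : ℕ) (i : ℤ) (h : ((n + 1 : ℕ) : ℤ) + i = k)
    (w : W R A (Mr i) (n + 1)) :
    epsN R A Mr k (lofN R A Mr k ⟨(n + 1, i), h⟩ w) = 0 := by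
  rw [epsN, descA_lof]
  rfl

lemma epsN_dN (k : ℤ) : (epsN R A Mr k).comp (dN R dMr k) = (dMr k).comp (epsN R A Mr (k + 1)) := by
  refine LinearMap.ext fun x => ?_
  refine NN_ind (f := ((epsN R A Mr k).comp (dN R dMr k)).toAddMonoidHom)
    (g := ((dMr k).comp (epsN R A Mr (k + 1))).toAddMonoidHom) ?_ x
  intro n i hq w
  obtain ⟨i, rfl⟩ : ∃ i', i = i' + 1 := ⟨i - 1, by omega⟩
  simp only [LinearMap.toAddMonoidHom_coe, LinearMap.comp_apply]
  rcases n with _ | _ | n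
  · obtain rfl : i = k := by push_cast at hq; omega
    rw [dN_zero, epsN_zero, epsN_zero, epsW_mW]
  · obtain rfl : i + 1 = k := by push_cast at hq; omega
    rw [dN_succ, map_add, map_zsmul, epsN_zero, epsN_succ, epsN_succ, eps_b]
    simp
  · rw [dN_succ, map_add, map_zsmul, epsN_succ, epsN_succ, epsN_succ]
    simp

variable (R A Mr) in
noncomputable def etaN (k : ℤ) : Mr k →ₗ[R] NN R A Mr k :=
  (lofN R A Mr k ⟨(0, k), by simp⟩).restrictScalars R ∘ₗ etaW R A (Mr k)

lemma epsN_etaN (k : ℤ) (m : Mr k) : epsN R A Mr k (etaN R A Mr k m) = m := by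
  rw [etaN, LinearMap.comp_apply, LinearMap.restrictScalars_apply, epsN_zero, epsW_etaW]

lemma dN_etaN (k : ℤ) (m : Mr (k + 1)) :
    dN R dMr k (etaN R A Mr (k + 1) m) = etaN R A Mr k (dMr k m) := by
  rw [etaN, LinearMap.comp_apply, LinearMap.restrictScalars_apply, dN_zero, etaW_mW]
  rfl

variable (R A Mr) in
noncomputable def hN (k : ℤ) : NN R A Mr k →ₗ[R] NN R A Mr (k + 1) :=
  descR (fun q => (-1 : ℤ) ^ (q.1.1 + 1) •
    ((lofN R A Mr (k + 1) ⟨(q.1.1 + 1, q.1.2), by have := q.2; push_cast; omega⟩).restrictScalars R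
      ∘ₗ sW R A (Mr q.1.2) q.1.1))

lemma hN_apply (k : ℤ) (n : ℕ) (i : ℤ) (h : (n : ℤ) + i = k) (w : W R A (Mr i) n) :
    hN R A Mr k (lofN R A Mr k ⟨(n, i), h⟩ w) = (-1 : ℤ) ^ (n + 1) •
      lofN R A Mr (k + 1) ⟨(n + 1, i), by push_cast; omega⟩ (sW R A (Mr i) n w) := by
  rw [hN, descR_lof]
  rfl

lemma hN_homotopy (k : ℤ) (x : NN R A Mr (k + 1)) :
    dN R dMr (k + 1) (hN R A Mr (k + 1) x) + hN R A Mr k (dN R dMr k x) =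
      x - etaN R A Mr (k + 1) (epsN R A Mr (k + 1) x) := by
  refine NN_indR (f := (dN R dMr (k + 1)).restrictScalars R ∘ₗ (hN R A Mr (k + 1)) +
      (hN R A Mr k) ∘ₗ (dN R dMr k).restrictScalars R)
    (g := LinearMap.id - (etaN R A Mr (k + 1)) ∘ₗ (epsN R A Mr (k + 1)).restrictScalars R) ?_ x
  intro n i hq w
  obtain ⟨i, rfl⟩ : ∃ i', i = i' + 1 := ⟨i - 1, by omega⟩
  simp only [LinearMap.comp_apply, LinearMap.add_apply, LinearMap.restrictScalars_apply,
    LinearMap.sub_apply, LinearMap.id_apply]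
  rcases n with _ | n
  · obtain rfl : i = k := by push_cast at hq; omega
    rw [hN_apply, map_zsmul, dN_succ, dN_zero, hN_apply, epsN_zero, bW_sW_zero, sW_mW, etaN]
    simp
  · rw [hN_apply, map_zsmul, dN_succ, dN_succ, map_add, map_zsmul, hN_apply, hN_apply, epsN_succ,
      bW_sW_succ, sW_mW, map_add, map_zsmul, map_zero]
    simp only [smul_add, smul_smul, pow_succ, sub_zero]
    have h1 : ((-1 : ℤ) ^ n) * (-1) ^ n = 1 := by rw [← mul_pow]; simp
    have h2 : (-1 : ℤ) ^ n * -1 * -1 * (-1) ^ n = 1 := by linear_combination h1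
    rw [h2]
    have h3 : (-1 : ℤ) ^ n * -1 * -1 * ((-1) ^ n * -1 * -1) = 1 := by linear_combination h1
    have h4 : (-1 : ℤ) ^ n * -1 * ((-1) ^ n * -1 * -1) = -1 := by linear_combination - h1
    rw [h3, h4]
    simp only [mul_neg, mul_one, neg_smul, one_smul, neg_neg]
    abel

lemma epsN_qiso :
    IsQIso (NN R A Mr) Mr (fun k => dN R dMr k) (fun k => dMr k) (fun k => epsN R A Mr k) := by
  intro k
  refine ⟨fun y hy => ⟨etaN R A Mr (k + 1) y, ?_, 0, ?_⟩, ?_⟩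
  · dsimp only at hy ⊢
    rw [dN_etaN, hy, map_zero]
  · dsimp only
    rw [epsN_etaN, sub_self, map_zero]
  · rintro x hx ⟨z, hz⟩
    dsimp only at hx hz ⊢
    refine ⟨etaN R A Mr (k + 1 + 1) z + hN R A Mr (k + 1) x, ?_⟩
    have := hN_homotopy (R := R) dMr k x
    rw [hx, map_zero, add_zero, hz] at this
    rw [map_add, dN_etaN, this]
    abel
end N
end BarAux

namespace BarAux
section T
set_option linter.unusedSectionVars false
variable (R A : Type) [CommRing R] [Ring A] [Algebra R A]
variable (Mr : ℤ → Type) [∀ k, AddCommGroup (Mr k)] [∀ k, Module R (Mr k)]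
    [∀ k, Module Aᵐᵒᵖ (Mr k)] [∀ k, IsScalarTower R Aᵐᵒᵖ (Mr k)]
variable (Ml : ℤ → Type) [∀ k, AddCommGroup (Ml k)] [∀ k, Module R (Ml k)]
    [∀ k, Module A (Ml k)] [∀ k, IsScalarTower R A (Ml k)]

/-- action map on one component -/
noncomputable def tc (M L : Type) [AddCommGroup M] [Module R M] [AddCommGroup L] [Module R L]
    [Module A L] [IsScalarTower R A L] (n : ℕ) :
    W R A M n ⊗[R] L →ₗ[R] M ⊗[R] (P R A n ⊗[R] L) :=
  (TensorProduct.assoc R M (P R A n) L).toLinearMap ∘ₗ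
    (TensorProduct.map LinearMap.id (TensorProduct.lift (Algebra.lsmul R R L).toLinearMap)) ∘ₗ
      (TensorProduct.assoc R (M ⊗[R] P R A n) A L).toLinearMap ∘ₗ
        (TensorProduct.map (TensorProduct.comm R A (M ⊗[R] P R A n)).toLinearMap LinearMap.id)

lemma tc_tmul (M L : Type) [AddCommGroup M] [Module R M] [AddCommGroup L] [Module R L]
    [Module A L] [IsScalarTower R A L] (n : ℕ) (a : A) (m : M) (t : P R A n) (y : L) :
    tc R A M L n ((a ⊗ₜ (m ⊗ₜ t)) ⊗ₜ y) = m ⊗ₜ (t ⊗ₜ (a • y)) := by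
  simp [tc]

/-- bilinear map on one total degree -/
noncomputable def tN (k j m : ℤ) (h : k + j = m) : NN R A Mr k →ₗ[R] Ml j →ₗ[R] BarC R A Mr Ml m :=
  descR (fun q => TensorProduct.curry
    (lofBar R A Mr Ml m ⟨(q.1.1, q.1.2, j), by have := q.2; dsimp only; omega⟩ ∘ₗ
      tc R A (Mr q.1.2) (Ml j) q.1.1))

variable {R A Mr Ml}

lemma tN_apply (k j m : ℤ) (h : k + j = m) (n : ℕ) (i : ℤ) (hq : (n : ℤ) + i = k) (a : A) (x : Mr i)
    (t : P R A n) (y : Ml j) :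
    tN R A Mr Ml k j m h (lofN R A Mr k ⟨(n, i), hq⟩ (a ⊗ₜ (x ⊗ₜ t))) y =
      lofBar R A Mr Ml m ⟨(n, i, j), by dsimp only; omega⟩ (x ⊗ₜ[R] (t ⊗ₜ[R] (a • y))) := by
  rw [tN, descR_lof]
  exact congrArg (lofBar R A Mr Ml m ⟨(n, i, j), by dsimp only; omega⟩)
    (tc_tmul R A (Mr i) (Ml j) n a x t y)

/-- two `R`-linear maps out of `NN` agree if they agree on generators -/
lemma NN_gen {k : ℤ} {X : Type} [AddCommMonoid X] [Module R X] {f g : NN R A Mr k →ₗ[R] X}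
    (h : ∀ (n : ℕ) (i : ℤ) (hq : (n : ℤ) + i = k) (a : A) (x : Mr i) (u : Fin n → A),
      f (lofN R A Mr k ⟨(n, i), hq⟩ (a ⊗ₜ (x ⊗ₜ PiTensorProduct.tprod R u))) =
      g (lofN R A Mr k ⟨(n, i), hq⟩ (a ⊗ₜ (x ⊗ₜ PiTensorProduct.tprod R u)))) (x : NN R A Mr k) :
    f x = g x := by
  refine NN_ind (f := f.toAddMonoidHom) (g := g.toAddMonoidHom) (fun n i hq w => ?_) x
  have : f ∘ₗ (lofN R A Mr k ⟨(n, i), hq⟩).restrictScalars R =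
      g ∘ₗ (lofN R A Mr k ⟨(n, i), hq⟩).restrictScalars R := by
    ext a m u
    exact h n i hq a m u
  exact LinearMap.congr_fun this w

lemma tN_bal (k j m : ℤ) (h : k + j = m) (x : NN R A Mr k) (b : A) (y : Ml j) :
    tN R A Mr Ml k j m h (op b • x) y = tN R A Mr Ml k j m h x (b • y) := by
  refine NN_gen (f := (tN R A Mr Ml k j m h).flip y ∘ₗ
      (Module.toModuleEnd R (NN R A Mr k) (op b) : NN R A Mr k →ₗ[R] NN R A Mr k))
    (g := (tN R A Mr Ml k j m h).flip (b • y)) ?_ x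
  intro n i hq a x u
  have : (Module.toModuleEnd R (NN R A Mr k) (op b) : NN R A Mr k →ₗ[R] NN R A Mr k)
      (lofN R A Mr k ⟨(n, i), hq⟩ (a ⊗ₜ (x ⊗ₜ PiTensorProduct.tprod R u))) =
      lofN R A Mr k ⟨(n, i), hq⟩ ((a * b) ⊗ₜ (x ⊗ₜ PiTensorProduct.tprod R u)) := by
    exact ((lofN R A Mr k ⟨(n, i), hq⟩).map_smul (op b) (a ⊗ₜ (x ⊗ₜ PiTensorProduct.tprod R u))).symm
  rw [LinearMap.comp_apply, this, LinearMap.flip_apply, LinearMap.flip_apply, tN_apply, tN_apply,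
    mul_smul]

variable (R A Mr Ml)
noncomputable def theta (m : ℤ) : TotT R A (NN R A Mr) Ml m →ₗ[R] BarC R A Mr Ml m :=
  DirectSum.toModule R _ _ (fun p => Submodule.liftQ _
    (TensorProduct.lift (tN R A Mr Ml p.1.1 p.1.2 m p.2)) (by
      rw [mixedRel, Submodule.span_le]
      rintro _ ⟨x, a, y, rfl⟩
      simp only [SetLike.mem_coe, LinearMap.mem_ker, map_sub, TensorProduct.lift.tmul]
      rw [tN_bal, sub_self]))

noncomputable def psic (m : ℤ) (q : {q : ℕ × ℤ × ℤ // (q.1 : ℤ) + q.2.1 + q.2.2 = m}) :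
    BarComp R A Mr Ml q.1 →ₗ[R] TotT R A (NN R A Mr) Ml m :=
  (lofTot R A (NN R A Mr) Ml m ⟨((q.1.1 : ℤ) + q.1.2.1, q.1.2.2), q.2⟩ ∘ₗ Submodule.mkQ _ ∘ₗ
      TensorProduct.map ((lofN R A Mr ((q.1.1 : ℤ) + q.1.2.1) ⟨(q.1.1, q.1.2.1), rfl⟩).restrictScalars R ∘ₗ
        TensorProduct.mk R A _ 1) LinearMap.id ∘ₗ
      (TensorProduct.assoc R (Mr q.1.2.1) (P R A q.1.1) (Ml q.1.2.2)).symm.toLinearMap :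
      (Mr q.1.2.1 ⊗[R] (P R A q.1.1 ⊗[R] Ml q.1.2.2)) →ₗ[R] _)

noncomputable def psi (m : ℤ) : BarC R A Mr Ml m →ₗ[R] TotT R A (NN R A Mr) Ml m :=
  DirectSum.toModule R _ _ (psic R A Mr Ml m)

variable {R A Mr Ml}
lemma theta_apply (m k j : ℤ) (h : k + j = m) (x : NN R A Mr k) (y : Ml j) :
    theta R A Mr Ml m (lofTot R A (NN R A Mr) Ml m ⟨(k, j), h⟩ (Submodule.Quotient.mk (x ⊗ₜ[R] y))) =
      tN R A Mr Ml k j m h x y := by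
  rw [theta, lofTot, DirectSum.toModule_lof]
  rfl

lemma theta_gen (m k j : ℤ) (h : k + j = m) (n : ℕ) (i : ℤ) (hq : (n : ℤ) + i = k) (a : A) (x : Mr i)
    (t : P R A n) (y : Ml j) :
    theta R A Mr Ml m (lofTot R A (NN R A Mr) Ml m ⟨(k, j), h⟩ (Submodule.Quotient.mk
      ((lofN R A Mr k ⟨(n, i), hq⟩ (a ⊗ₜ (x ⊗ₜ t))) ⊗ₜ[R] y))) =
      lofBar R A Mr Ml m ⟨(n, i, j), by dsimp only; omega⟩ (x ⊗ₜ[R] (t ⊗ₜ[R] (a • y))) := by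
  rw [theta_apply, tN_apply]

lemma psi_gen (m : ℤ) (n : ℕ) (i j : ℤ) (h : (n : ℤ) + i + j = m) (x : Mr i)
    (t : P R A n) (y : Ml j) :
    psi R A Mr Ml m (lofBar R A Mr Ml m ⟨(n, i, j), h⟩ (x ⊗ₜ[R] (t ⊗ₜ[R] y))) =
      lofTot R A (NN R A Mr) Ml m ⟨((n : ℤ) + i, j), h⟩ (Submodule.Quotient.mk
      ((lofN R A Mr _ ⟨(n, i), rfl⟩ (1 ⊗ₜ (x ⊗ₜ t))) ⊗ₜ[R] y)) := by
  exact (DirectSum.toModule_lof R (φ := psic R A Mr Ml m) ⟨(n, i, j), h⟩ _).trans rfl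

lemma Tot_ind (N : ℤ → Type) [∀ k, AddCommGroup (N k)] [∀ k, Module R (N k)] [∀ k, Module Aᵐᵒᵖ (N k)]
    {m : ℤ} {X : Type} [AddCommMonoid X] [Module R X] {f g : TotT R A N Ml m →ₗ[R] X}
    (H : ∀ (k j : ℤ) (h : k + j = m) (x : N k) (y : Ml j),
      f (lofTot R A N Ml m ⟨(k, j), h⟩ (Submodule.Quotient.mk (x ⊗ₜ[R] y))) =
      g (lofTot R A N Ml m ⟨(k, j), h⟩ (Submodule.Quotient.mk (x ⊗ₜ[R] y)))) : f = g := by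
  refine DirectSum.linearMap_ext R ?_
  rintro ⟨⟨k, j⟩, h⟩
  have key : ∀ f g : TensA R A (N k) (Ml j) →ₗ[R] X,
      (∀ x y, f (Submodule.Quotient.mk (x ⊗ₜ y)) = g (Submodule.Quotient.mk (x ⊗ₜ y))) → f = g := by
    intro f g hh
    refine LinearMap.ext fun z => ?_
    obtain ⟨z, rfl⟩ := Submodule.Quotient.mk_surjective _ z
    have : f ∘ₗ (mixedRel R A (N k) (Ml j)).mkQ = g ∘ₗ (mixedRel R A (N k) (Ml j)).mkQ :=
      TensorProduct.ext' fun x y => hh x y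
    exact LinearMap.congr_fun this z
  exact key _ _ (fun x y => H k j h x y)

lemma Bar_ind {m : ℤ} {X : Type} [AddCommMonoid X] [Module R X] {f g : BarC R A Mr Ml m →ₗ[R] X}
    (H : ∀ (n : ℕ) (i j : ℤ) (h : (n : ℤ) + i + j = m) (x : Mr i) (t : P R A n) (y : Ml j),
      f (lofBar R A Mr Ml m ⟨(n, i, j), h⟩ (x ⊗ₜ[R] (t ⊗ₜ[R] y))) =
      g (lofBar R A Mr Ml m ⟨(n, i, j), h⟩ (x ⊗ₜ[R] (t ⊗ₜ[R] y)))) : f = g := by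
  refine DirectSum.linearMap_ext R ?_
  rintro ⟨⟨n, i, j⟩, h⟩
  have : ∀ f g : (Mr i ⊗[R] (P R A n ⊗[R] Ml j)) →ₗ[R] X,
      (∀ x t y, f (x ⊗ₜ (t ⊗ₜ y)) = g (x ⊗ₜ (t ⊗ₜ y))) → f = g := by
    intro f g h
    refine TensorProduct.ext' fun x z => ?_
    have : f ∘ₗ TensorProduct.mk R _ _ x = g ∘ₗ TensorProduct.mk R _ _ x :=
      TensorProduct.ext' fun t y => h x t y
    exact LinearMap.congr_fun this z
  exact this _ _ (fun x t y => H n i j h x t y)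

variable (R A Mr Ml) in
noncomputable def thetaE (m : ℤ) : TotT R A (NN R A Mr) Ml m ≃ₗ[R] BarC R A Mr Ml m :=
  LinearEquiv.ofLinearMap (theta R A Mr Ml m) (psi R A Mr Ml m)
    (by
      refine Bar_ind ?_
      intro n i j h x t y
      rw [LinearMap.comp_apply, psi_gen, theta_gen, one_smul, LinearMap.id_apply])
    (by
      refine Tot_ind _ ?_
      intro k j h x y
      let L : NN R A Mr k →ₗ[R] TotT R A (NN R A Mr) Ml m :=
        lofTot R A (NN R A Mr) Ml m ⟨(k, j), h⟩ ∘ₗ Submodule.mkQ _ ∘ₗ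
          (TensorProduct.mk R (NN R A Mr k) (Ml j)).flip y
      refine NN_gen (f := psi R A Mr Ml m ∘ₗ theta R A Mr Ml m ∘ₗ L) (g := L) ?_ x
      intro n i hq a v u
      subst hq
      change psi R A Mr Ml m (theta R A Mr Ml m (lofTot R A (NN R A Mr) Ml m ⟨(n + i, j), h⟩
        (Submodule.Quotient.mk (_ ⊗ₜ[R] y)))) = lofTot R A (NN R A Mr) Ml m ⟨(n + i, j), h⟩
        (Submodule.Quotient.mk (_ ⊗ₜ[R] y))
      rw [theta_gen, psi_gen]
      congr 1
      symm
      rw [Submodule.Quotient.eq]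
      refine Submodule.subset_span ⟨lofN R A Mr _ ⟨(n, i), rfl⟩ (1 ⊗ₜ (v ⊗ₜ PiTensorProduct.tprod R u)),
        a, y, ?_⟩
      rw [← map_smul, TensorProduct.smul_tmul', op_smul_eq_mul, one_mul])

end T
end BarAux

namespace BarAux
section F
set_option linter.unusedSectionVars false
variable {R A : Type} [CommRing R] [Ring A] [Algebra R A]
variable {Mr : ℤ → Type} [∀ k, AddCommGroup (Mr k)] [∀ k, Module R (Mr k)]
    [∀ k, Module Aᵐᵒᵖ (Mr k)] [∀ k, IsScalarTower R Aᵐᵒᵖ (Mr k)]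
variable {Ml : ℤ → Type} [∀ k, AddCommGroup (Ml k)] [∀ k, Module R (Ml k)]
    [∀ k, Module A (Ml k)] [∀ k, IsScalarTower R A (Ml k)]

lemma tN_bW (k j m : ℤ) (h : k + j = m) (n : ℕ) (i : ℤ) (hq : (n : ℤ) + i = k) (a : A) (x : Mr i)
    (f : Fin (n + 1) → A) (y : Ml j) (h' : (n : ℤ) + i + j = m) :
    tN R A Mr Ml k j m h (lofN R A Mr k ⟨(n, i), hq⟩
      (bW R A (Mr i) n (a ⊗ₜ (x ⊗ₜ PiTensorProduct.tprod R f)))) y =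
      lofBar R A Mr Ml m ⟨(n, i, j), h'⟩
            ((op (f 0) • x) ⊗ₜ[R]
              ((PiTensorProduct.tprod R (fun l : Fin n => f l.succ)) ⊗ₜ[R] (a • y)))
        + (∑ l : Fin n, ((-1 : ℤ) ^ ((l : ℕ) + 1)) •
            lofBar R A Mr Ml m ⟨(n, i, j), h'⟩
              (x ⊗ₜ[R] ((PiTensorProduct.tprod R (mergeAt f l)) ⊗ₜ[R] (a • y))))
        + ((-1 : ℤ) ^ (n + 1)) • lofBar R A Mr Ml m ⟨(n, i, j), h'⟩
            (x ⊗ₜ[R] ((PiTensorProduct.tprod R (fun l : Fin n => f l.castSucc)) ⊗ₜ[R]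
              (f (Fin.last n) • a • y))) := by
  rw [bW_formula, map_add, map_add, map_add, map_add, LinearMap.add_apply, LinearMap.add_apply,
    map_sum, map_sum, LinearMap.sum_apply, map_zsmul, map_zsmul, LinearMap.smul_apply,
    tN_apply, tN_apply, mul_smul]
  congr 2
  refine Finset.sum_congr rfl fun l _ => ?_
  rw [map_zsmul, map_zsmul, LinearMap.smul_apply, tN_apply]

lemma tN_d (dMr : ∀ k : ℤ, Mr (k + 1) →ₗ[Aᵐᵒᵖ] Mr k) (dMl : ∀ k : ℤ, Ml (k + 1) →ₗ[A] Ml k)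
    (dB : ∀ m : ℤ, BarC R A Mr Ml (m + 1) →ₗ[R] BarC R A Mr Ml m)
    (hdB0 : ∀ (m i j : ℤ) (h : ((0 : ℕ) : ℤ) + (i + 1) + (j + 1) = m + 1)
        (h1 : ((0 : ℕ) : ℤ) + i + (j + 1) = m) (h2 : ((0 : ℕ) : ℤ) + (i + 1) + j = m)
        (x : Mr (i + 1)) (f : Fin 0 → A) (y : Ml (j + 1)),
      dB m (lofBar R A Mr Ml (m + 1) ⟨(0, i + 1, j + 1), h⟩
          (x ⊗ₜ[R] ((PiTensorProduct.tprod R f) ⊗ₜ[R] y))) =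
        lofBar R A Mr Ml m ⟨(0, i, j + 1), h1⟩
            ((dMr i x) ⊗ₜ[R] ((PiTensorProduct.tprod R f) ⊗ₜ[R] y))
        + ((i + 1).negOnePow : ℤ) • lofBar R A Mr Ml m ⟨(0, i + 1, j), h2⟩
            (x ⊗ₜ[R] ((PiTensorProduct.tprod R f) ⊗ₜ[R] (dMl j y))))
    (hdBsucc : ∀ (m : ℤ) (n : ℕ) (i j : ℤ)
        (h : ((n + 1 : ℕ) : ℤ) + (i + 1) + (j + 1) = m + 1)
        (h1 : (n : ℤ) + (i + 1) + (j + 1) = m) (h2 : ((n + 1 : ℕ) : ℤ) + i + (j + 1) = m)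
        (h3 : ((n + 1 : ℕ) : ℤ) + (i + 1) + j = m)
        (x : Mr (i + 1)) (f : Fin (n + 1) → A) (y : Ml (j + 1)),
      dB m (lofBar R A Mr Ml (m + 1) ⟨(n + 1, i + 1, j + 1), h⟩
          (x ⊗ₜ[R] ((PiTensorProduct.tprod R f) ⊗ₜ[R] y))) =
        lofBar R A Mr Ml m ⟨(n, i + 1, j + 1), h1⟩
            ((op (f 0) • x) ⊗ₜ[R]
              ((PiTensorProduct.tprod R (fun l : Fin n => f l.succ)) ⊗ₜ[R] y))
        + (∑ l : Fin n, ((-1 : ℤ) ^ ((l : ℕ) + 1)) •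
            lofBar R A Mr Ml m ⟨(n, i + 1, j + 1), h1⟩
              (x ⊗ₜ[R] ((PiTensorProduct.tprod R (mergeAt f l)) ⊗ₜ[R] y)))
        + ((-1 : ℤ) ^ (n + 1)) • lofBar R A Mr Ml m ⟨(n, i + 1, j + 1), h1⟩
            (x ⊗ₜ[R] ((PiTensorProduct.tprod R (fun l : Fin n => f l.castSucc)) ⊗ₜ[R]
              (f (Fin.last n) • y)))
        + ((-1 : ℤ) ^ (n + 1)) • lofBar R A Mr Ml m ⟨(n + 1, i, j + 1), h2⟩
            ((dMr i x) ⊗ₜ[R] ((PiTensorProduct.tprod R f) ⊗ₜ[R] y))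
        + ((-1 : ℤ) ^ (n + 1) * ((i + 1).negOnePow : ℤ)) •
            lofBar R A Mr Ml m ⟨(n + 1, i + 1, j), h3⟩
              (x ⊗ₜ[R] ((PiTensorProduct.tprod R f) ⊗ₜ[R] (dMl j y))))
    (k i j : ℤ) (h : i + 1 + (j + 1) = k + 1) (h1 : i + (j + 1) = k) (h2 : i + 1 + j = k)
    (x : NN R A Mr (i + 1)) (y : Ml (j + 1)) :
    dB k (tN R A Mr Ml (i + 1) (j + 1) (k + 1) h x y) =
      tN R A Mr Ml i (j + 1) k h1 (dN R dMr i x) y +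
        ((i + 1).negOnePow : ℤ) • tN R A Mr Ml (i + 1) j k h2 x (dMl j y) := by
  refine NN_gen (f := dB k ∘ₗ (tN R A Mr Ml (i + 1) (j + 1) (k + 1) h).flip y)
    (g := (tN R A Mr Ml i (j + 1) k h1).flip y ∘ₗ (dN R dMr i).restrictScalars R +
      ((i + 1).negOnePow : ℤ) • (tN R A Mr Ml (i + 1) j k h2).flip (dMl j y)) ?_ x
  intro n i' hq a v u
  obtain ⟨i', rfl⟩ : ∃ i'', i' = i'' + 1 := ⟨i' - 1, by omega⟩
  rw [LinearMap.comp_apply, LinearMap.add_apply, LinearMap.comp_apply, LinearMap.smul_apply,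
    LinearMap.flip_apply, LinearMap.flip_apply, LinearMap.flip_apply, LinearMap.restrictScalars_apply]
  rw [tN_apply, tN_apply, ← map_smul]
  cases n with
  | zero =>
    rw [hdB0 _ _ _ _ (by omega) (by omega), dN_zero, mW_tmul, tN_apply]
    obtain rfl : i = i' := by push_cast at hq; omega
    rfl
  | succ n =>
    rw [hdBsucc _ _ _ _ _ (by omega) (by omega) (by omega), dN_succ, mW_tmul, map_add, map_zsmul, LinearMap.add_apply, LinearMap.smul_apply,
      tN_apply, tN_bW]
    have : ((-1 : ℤ) ^ (n + 1) * ((i' + 1).negOnePow : ℤ)) = ((i + 1).negOnePow : ℤ) := by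
      rw [← hq, Int.negOnePow_add ((n + 1 : ℕ) : ℤ), Units.val_mul, Int.negOnePow_def ((n + 1 : ℕ) : ℤ),
        zpow_natCast]
      rfl
    rw [this]

lemma p_theta (p : ∀ m : ℤ, BarC R A Mr Ml m →ₗ[R] TotT R A Mr Ml m)
    (hp0 : ∀ (m i j : ℤ) (h : ((0 : ℕ) : ℤ) + i + j = m) (h1 : i + j = m)
        (x : Mr i) (f : Fin 0 → A) (y : Ml j),
      p m (lofBar R A Mr Ml m ⟨(0, i, j), h⟩
          (x ⊗ₜ[R] ((PiTensorProduct.tprod R f) ⊗ₜ[R] y))) =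
        lofTot R A Mr Ml m ⟨(i, j), h1⟩ (Submodule.Quotient.mk (x ⊗ₜ[R] y)))
    (hp1 : ∀ (m : ℤ) (n : ℕ) (i j : ℤ) (h : ((n + 1 : ℕ) : ℤ) + i + j = m)
        (v : Mr i ⊗[R] ((PiTensorProduct R (fun _ : Fin (n + 1) => A)) ⊗[R] Ml j)),
      p m (lofBar R A Mr Ml m ⟨(n + 1, i, j), h⟩ v) = 0)
    (k i j : ℤ) (h : i + j = k) (x : NN R A Mr i) (y : Ml j) :
    p k (tN R A Mr Ml i j k h x y) =
      lofTot R A Mr Ml k ⟨(i, j), h⟩ (Submodule.Quotient.mk ((epsN R A Mr i x) ⊗ₜ[R] y)) := by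
  let L : Mr i →ₗ[R] TotT R A Mr Ml k :=
    lofTot R A Mr Ml k ⟨(i, j), h⟩ ∘ₗ Submodule.mkQ _ ∘ₗ
      (TensorProduct.mk R (Mr i) (Ml j)).flip y
  refine NN_gen (f := p k ∘ₗ (tN R A Mr Ml i j k h).flip y)
    (g := L ∘ₗ (epsN R A Mr i).restrictScalars R) ?_ x
  intro n i' hq a v u
  rw [LinearMap.comp_apply, LinearMap.comp_apply,
    LinearMap.flip_apply, LinearMap.restrictScalars_apply]
  rw [tN_apply]
  cases n with
  | zero =>
    obtain rfl : i = i' := by push_cast at hq; omega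
    rw [hp0 _ _ _ _ h, epsN_zero]
    refine Eq.trans ?_ (congrArg L (epsW_tmul R A (Mr i) a v u).symm)
    refine congrArg (lofTot R A Mr Ml k ⟨(i, j), h⟩) ?_
    refine ((Submodule.Quotient.eq (mixedRel R A (Mr i) (Ml j))).2 ?_).symm
    exact Submodule.subset_span ⟨v, a, y, rfl⟩
  | succ n =>
    rw [epsN_succ, map_zero]
    exact hp1 k n i' j _ _

end F
end BarAux

/-- If `Ml` is a dg-flat chain complex of left `A`-modules, then the canonical
augmentation map `B(Mr, A, Ml) → Mr ⊗_A Ml` from the two-sided bar complex to the total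
tensor product complex over `A` is a quasi-isomorphism of `R`-chain complexes. -/
theorem stmt_9 (R : Type) [CommRing R] (A : Type) [Ring A] [Algebra R A]
    -- the complex of right `A`-modules `Mr`
    (Mr : ℤ → Type) [∀ k, AddCommGroup (Mr k)] [∀ k, Module R (Mr k)]
    [∀ k, Module Aᵐᵒᵖ (Mr k)] [∀ k, IsScalarTower R Aᵐᵒᵖ (Mr k)]
    (dMr : ∀ k : ℤ, Mr (k + 1) →ₗ[Aᵐᵒᵖ] Mr k)
    (hdMr : ∀ k, (dMr k).comp (dMr (k + 1)) = 0)
    -- the complex of left `A`-modules `Ml`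
    (Ml : ℤ → Type) [∀ k, AddCommGroup (Ml k)] [∀ k, Module R (Ml k)]
    [∀ k, Module A (Ml k)] [∀ k, IsScalarTower R A (Ml k)]
    (dMl : ∀ k : ℤ, Ml (k + 1) →ₗ[A] Ml k)
    (hdMl : ∀ k, (dMl k).comp (dMl (k + 1)) = 0)
    -- `Ml` is dg-flat: tensoring over `A` with `Ml` preserves quasi-isomorphisms of
    -- complexes of right `A`-modules
    (hflat : ∀ (N N' : ℤ → Type)
      [∀ k, AddCommGroup (N k)] [∀ k, Module R (N k)] [∀ k, Module Aᵐᵒᵖ (N k)]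
      [∀ k, IsScalarTower R Aᵐᵒᵖ (N k)]
      [∀ k, AddCommGroup (N' k)] [∀ k, Module R (N' k)] [∀ k, Module Aᵐᵒᵖ (N' k)]
      [∀ k, IsScalarTower R Aᵐᵒᵖ (N' k)]
      (dN : ∀ k : ℤ, N (k + 1) →ₗ[Aᵐᵒᵖ] N k)
      (_ : ∀ k, (dN k).comp (dN (k + 1)) = 0)
      (dN' : ∀ k : ℤ, N' (k + 1) →ₗ[Aᵐᵒᵖ] N' k)
      (_ : ∀ k, (dN' k).comp (dN' (k + 1)) = 0)
      (φ : ∀ k : ℤ, N k →ₗ[Aᵐᵒᵖ] N' k)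
      (_ : ∀ k, (φ k).comp (dN k) = (dN' k).comp (φ (k + 1)))
      (dT : ∀ k : ℤ, TotT R A N Ml (k + 1) →ₗ[R] TotT R A N Ml k)
      (_ : ∀ (k i j : ℤ) (h : i + 1 + (j + 1) = k + 1) (x : N (i + 1)) (y : Ml (j + 1)),
        dT k (lofTot R A N Ml (k + 1) ⟨(i + 1, j + 1), h⟩
            (Submodule.Quotient.mk (x ⊗ₜ[R] y))) =
          lofTot R A N Ml k ⟨(i, j + 1), by dsimp only; omega⟩
              (Submodule.Quotient.mk ((dN i x) ⊗ₜ[R] y))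
          + ((i + 1).negOnePow : ℤ) • lofTot R A N Ml k ⟨(i + 1, j), by dsimp only; omega⟩
              (Submodule.Quotient.mk (x ⊗ₜ[R] (dMl j y))))
      (dT' : ∀ k : ℤ, TotT R A N' Ml (k + 1) →ₗ[R] TotT R A N' Ml k)
      (_ : ∀ (k i j : ℤ) (h : i + 1 + (j + 1) = k + 1) (x : N' (i + 1)) (y : Ml (j + 1)),
        dT' k (lofTot R A N' Ml (k + 1) ⟨(i + 1, j + 1), h⟩
            (Submodule.Quotient.mk (x ⊗ₜ[R] y))) =
          lofTot R A N' Ml k ⟨(i, j + 1), by dsimp only; omega⟩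
              (Submodule.Quotient.mk ((dN' i x) ⊗ₜ[R] y))
          + ((i + 1).negOnePow : ℤ) • lofTot R A N' Ml k ⟨(i + 1, j), by dsimp only; omega⟩
              (Submodule.Quotient.mk (x ⊗ₜ[R] (dMl j y))))
      (Φ : ∀ k : ℤ, TotT R A N Ml k →ₗ[R] TotT R A N' Ml k)
      (_ : ∀ (k i j : ℤ) (h : i + j = k) (x : N i) (y : Ml j),
        Φ k (lofTot R A N Ml k ⟨(i, j), h⟩ (Submodule.Quotient.mk (x ⊗ₜ[R] y))) =
          lofTot R A N' Ml k ⟨(i, j), h⟩ (Submodule.Quotient.mk ((φ i x) ⊗ₜ[R] y))),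
      IsQIso N N' (fun k => dN k) (fun k => dN' k) (fun k => φ k) →
        IsQIso (TotT R A N Ml) (TotT R A N' Ml)
          (fun k => dT k) (fun k => dT' k) (fun k => Φ k))
    -- the bar differential
    (dB : ∀ m : ℤ, BarC R A Mr Ml (m + 1) →ₗ[R] BarC R A Mr Ml m)
    (hdB0 : ∀ (m i j : ℤ) (h : ((0 : ℕ) : ℤ) + (i + 1) + (j + 1) = m + 1)
        (x : Mr (i + 1)) (f : Fin 0 → A) (y : Ml (j + 1)),
      dB m (lofBar R A Mr Ml (m + 1) ⟨(0, i + 1, j + 1), h⟩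
          (x ⊗ₜ[R] ((PiTensorProduct.tprod R f) ⊗ₜ[R] y))) =
        lofBar R A Mr Ml m ⟨(0, i, j + 1), by dsimp only; omega⟩
            ((dMr i x) ⊗ₜ[R] ((PiTensorProduct.tprod R f) ⊗ₜ[R] y))
        + ((i + 1).negOnePow : ℤ) • lofBar R A Mr Ml m ⟨(0, i + 1, j), by dsimp only; omega⟩
            (x ⊗ₜ[R] ((PiTensorProduct.tprod R f) ⊗ₜ[R] (dMl j y))))
    (hdBsucc : ∀ (m : ℤ) (n : ℕ) (i j : ℤ)
        (h : ((n + 1 : ℕ) : ℤ) + (i + 1) + (j + 1) = m + 1)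
        (x : Mr (i + 1)) (f : Fin (n + 1) → A) (y : Ml (j + 1)),
      dB m (lofBar R A Mr Ml (m + 1) ⟨(n + 1, i + 1, j + 1), h⟩
          (x ⊗ₜ[R] ((PiTensorProduct.tprod R f) ⊗ₜ[R] y))) =
        -- the simplicial (bar) faces
        lofBar R A Mr Ml m ⟨(n, i + 1, j + 1), by dsimp only; omega⟩
            ((op (f 0) • x) ⊗ₜ[R]
              ((PiTensorProduct.tprod R (fun l : Fin n => f l.succ)) ⊗ₜ[R] y))
        + (∑ l : Fin n, ((-1 : ℤ) ^ ((l : ℕ) + 1)) •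
            lofBar R A Mr Ml m ⟨(n, i + 1, j + 1), by dsimp only; omega⟩
              (x ⊗ₜ[R] ((PiTensorProduct.tprod R (mergeAt f l)) ⊗ₜ[R] y)))
        + ((-1 : ℤ) ^ (n + 1)) • lofBar R A Mr Ml m ⟨(n, i + 1, j + 1), by dsimp only; omega⟩
            (x ⊗ₜ[R] ((PiTensorProduct.tprod R (fun l : Fin n => f l.castSucc)) ⊗ₜ[R]
              (f (Fin.last n) • y)))
        -- the internal differentials, with Koszul signs
        + ((-1 : ℤ) ^ (n + 1)) • lofBar R A Mr Ml m ⟨(n + 1, i, j + 1), by dsimp only; omega⟩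
            ((dMr i x) ⊗ₜ[R] ((PiTensorProduct.tprod R f) ⊗ₜ[R] y))
        + ((-1 : ℤ) ^ (n + 1) * ((i + 1).negOnePow : ℤ)) •
            lofBar R A Mr Ml m ⟨(n + 1, i + 1, j), by dsimp only; omega⟩
              (x ⊗ₜ[R] ((PiTensorProduct.tprod R f) ⊗ₜ[R] (dMl j y))))
    -- the differential of the target total tensor product complex `Mr ⊗_A Ml`
    (dT : ∀ k : ℤ, TotT R A Mr Ml (k + 1) →ₗ[R] TotT R A Mr Ml k)
    (hdT : ∀ (k i j : ℤ) (h : i + 1 + (j + 1) = k + 1) (x : Mr (i + 1)) (y : Ml (j + 1)),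
      dT k (lofTot R A Mr Ml (k + 1) ⟨(i + 1, j + 1), h⟩
          (Submodule.Quotient.mk (x ⊗ₜ[R] y))) =
        lofTot R A Mr Ml k ⟨(i, j + 1), by dsimp only; omega⟩
            (Submodule.Quotient.mk ((dMr i x) ⊗ₜ[R] y))
        + ((i + 1).negOnePow : ℤ) • lofTot R A Mr Ml k ⟨(i + 1, j), by dsimp only; omega⟩
            (Submodule.Quotient.mk (x ⊗ₜ[R] (dMl j y))))
    -- the augmentation map, sending `x ⊗ y` in simplicial level `0` to `x ⊗_A y` and
    -- vanishing on all higher simplicial levels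
    (p : ∀ m : ℤ, BarC R A Mr Ml m →ₗ[R] TotT R A Mr Ml m)
    (hp0 : ∀ (m i j : ℤ) (h : ((0 : ℕ) : ℤ) + i + j = m)
        (x : Mr i) (f : Fin 0 → A) (y : Ml j),
      p m (lofBar R A Mr Ml m ⟨(0, i, j), h⟩
          (x ⊗ₜ[R] ((PiTensorProduct.tprod R f) ⊗ₜ[R] y))) =
        lofTot R A Mr Ml m ⟨(i, j), by dsimp only; omega⟩ (Submodule.Quotient.mk (x ⊗ₜ[R] y)))
    (hp1 : ∀ (m : ℤ) (n : ℕ) (i j : ℤ) (h : ((n + 1 : ℕ) : ℤ) + i + j = m)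
        (v : Mr i ⊗[R] ((PiTensorProduct R (fun _ : Fin (n + 1) => A)) ⊗[R] Ml j)),
      p m (lofBar R A Mr Ml m ⟨(n + 1, i, j), h⟩ v) = 0) :
    IsQIso (BarC R A Mr Ml) (TotT R A Mr Ml)
      (fun m => dB m) (fun m => dT m) (fun m => p m) := by
  classical
  let Θ := BarAux.thetaE R A Mr Ml
  have hΘ : ∀ (m k j : ℤ) (h : k + j = m) (x : BarAux.NN R A Mr k) (y : Ml j),
      Θ m (lofTot R A (BarAux.NN R A Mr) Ml m ⟨(k, j), h⟩ (Submodule.Quotient.mk (x ⊗ₜ[R] y))) =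
        BarAux.tN R A Mr Ml k j m h x y := BarAux.theta_apply
  have key := hflat (BarAux.NN R A Mr) Mr (BarAux.dN R dMr) (BarAux.dN_dN dMr hdMr) dMr hdMr
    (BarAux.epsN R A Mr) (BarAux.epsN_dN dMr)
    (fun k => (Θ k).symm.toLinearMap ∘ₗ dB k ∘ₗ (Θ (k + 1)).toLinearMap)
    (by
      intro k i j h x y
      refine (Θ k).symm_apply_eq.2 ?_
      refine (congrArg (dB k) (hΘ (k + 1) (i + 1) (j + 1) h x y)).trans ?_
      refine (BarAux.tN_d dMr dMl dB (fun m i j h _ _ => hdB0 m i j h)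
        (fun m n i j h _ _ _ => hdBsucc m n i j h) k i j h (by omega) (by omega) x y).trans ?_
      rw [map_add, map_zsmul, hΘ, hΘ])
    dT hdT
    (fun k => p k ∘ₗ (Θ k).toLinearMap)
    (by
      intro k i j h x y
      refine (congrArg (p k) (hΘ k i j h x y)).trans ?_
      exact BarAux.p_theta p (fun m i j h _ => hp0 m i j h) hp1 k i j h x y)
    (BarAux.epsN_qiso dMr)
  intro k
  obtain ⟨h1, h2⟩ := key k
  have hd : ∀ k x, Θ k ((Θ k).symm (dB k (Θ (k + 1) x))) = dB k (Θ (k + 1) x) :=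
    fun k x => (Θ k).apply_symm_apply _
  constructor
  · intro y hy
    obtain ⟨x, hx, z, hz⟩ := h1 y hy
    refine ⟨Θ (k + 1) x, ?_, z, hz⟩
    exact (hd k x).symm.trans ((congrArg (Θ k) hx).trans (map_zero (Θ k)))
  · intro x hx ⟨z, hz⟩
    obtain ⟨x, rfl⟩ := (Θ (k + 1)).surjective x
    obtain ⟨w, hw⟩ := h2 x ((congrArg (Θ k).symm hx).trans (map_zero (Θ k).symm)) ⟨z, hz⟩
    exact ⟨Θ (k + 1 + 1) w, (congrArg (Θ (k + 1)) hw).trans (hd (k + 1) w)⟩
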